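/- Assume n ≥ 1 and fix arities r_1, ..., r_k ≥ 1. Let A_1, ..., A_n and B be structures each carrying relations R_j ⊆ (Fin r_j → ·) for j = 1, ..., k. Then there is a homomorphism from the direct product of A_1, ..., A_n to B if and only if there is a homomorphism from the direct product of A_1*, ..., A_n* to B*. -/

import Mathlib

/-- Sum of the arities of the relations preceding the `j`-th one. -/
def blockOffset {k : ℕ} (r : Fin k → ℕ) (j : Fin k) : ℕ :=
  ∑ j' ∈ Finset.Iio j, r j'

lemma blockOffset_add_le {k : ℕ} (r : Fin k → ℕ) (j : Fin k) :
    blockOffset r j + r j ≤ ∑ j', r j' := by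
  have : blockOffset r j + r j = ∑ j' ∈ insert j (Finset.Iio j), r j' := by
    rw [Finset.sum_insert (by simp), blockOffset]; omega
  rw [this]
  exact Finset.sum_le_sum_of_subset (Finset.subset_univ _)

/-- The padded tuple of arity `∑ j', r j'` whose entries on the `j`-th block of
positions are `some (t ·)` and whose entries elsewhere are `none`. -/
def padded {k : ℕ} (r : Fin k → ℕ) {A : Type} (j : Fin k) (t : Fin (r j) → A)
    (p : Fin (∑ j', r j')) : Option A :=
  if hp : blockOffset r j ≤ (p : ℕ) ∧ (p : ℕ) < blockOffset r j + r j
  then some (t ⟨(p : ℕ) - blockOffset r j, by omega⟩)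
  else none

/-- The single relation of arity `∑ j', r j'` of the structure `A*`: the constant
`none` tuple together with all padded tuples of tuples of the relations of `A`. -/
def starRel {k : ℕ} (r : Fin k → ℕ) {A : Type} (R : ∀ j, Set (Fin (r j) → A)) :
    Set (Fin (∑ j', r j') → Option A) :=
  {v | (v = fun _ => none) ∨ ∃ j, ∃ t ∈ R j, v = padded r j t}

lemma blockOffset_lt {k : ℕ} (r : Fin k → ℕ) {j j' : Fin k} (h : j < j') :
    blockOffset r j + r j ≤ blockOffset r j' := by
  have : blockOffset r j + r j = ∑ i ∈ insert j (Finset.Iio j), r i := by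
    rw [Finset.sum_insert (by simp), blockOffset]; omega
  rw [this]
  apply Finset.sum_le_sum_of_subset
  intro x hx
  simp only [Finset.mem_insert, Finset.mem_Iio] at hx ⊢
  rcases hx with rfl | hx
  · exact h
  · exact hx.trans h

lemma block_unique {k : ℕ} (r : Fin k → ℕ) {j j' : Fin k} {p : ℕ}
    (h : blockOffset r j ≤ p ∧ p < blockOffset r j + r j)
    (h' : blockOffset r j' ≤ p ∧ p < blockOffset r j' + r j') : j = j' := by
  rcases lt_trichotomy j j' with hl | he | hl
  · have := blockOffset_lt r hl; omega
  · exact he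
  · have := blockOffset_lt r hl; omega

lemma padded_ne_none {k : ℕ} (r : Fin k → ℕ) {A : Type} (j : Fin k) (t : Fin (r j) → A)
    (p : Fin (∑ j', r j')) (h : padded r j t p ≠ none) :
    blockOffset r j ≤ (p : ℕ) ∧ (p : ℕ) < blockOffset r j + r j := by
  by_contra hc
  exact h (by simp only [padded, dif_neg hc])

lemma padded_at {k : ℕ} (r : Fin k → ℕ) {A : Type} (j : Fin k) (t : Fin (r j) → A)
    (q : Fin (r j)) (hq : blockOffset r j + q < ∑ j', r j') :
    padded r j t ⟨blockOffset r j + q, hq⟩ = some (t q) := by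
  have : blockOffset r j ≤ blockOffset r j + (q : ℕ) ∧
    blockOffset r j + (q : ℕ) < blockOffset r j + r j := by omega
  simp only [padded, dif_pos this]
  congr 2
  ext
  simp

/-- There is a homomorphism from the direct product of `A_1, ..., A_n` to `B`
(preserving each relation `R_j`, computed relation-wise in the product) iff
there is a homomorphism from the direct product of `A_1*, ..., A_n*` to `B*`
(preserving the unary relation `P` and the single relation of the star
construction, computed relation-wise in the product). -/
theorem stmt_3 (n : ℕ) (hn : 1 ≤ n) (k : ℕ) (r : Fin k → ℕ) (hr : ∀ j, 1 ≤ r j)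
    (A : Fin n → Type) (B : Type)
    (RA : ∀ i, ∀ j, Set (Fin (r j) → A i)) (RB : ∀ j, Set (Fin (r j) → B)) :
    (∃ h : (∀ i, A i) → B, ∀ (j : Fin k) (t : Fin (r j) → ∀ i, A i),
        (∀ i, (fun p => t p i) ∈ RA i j) → (fun p => h (t p)) ∈ RB j) ↔
    (∃ g : (∀ i, Option (A i)) → Option B,
        (∀ v : ∀ i, Option (A i),
          (∀ i, v i ∈ Set.range (some : A i → Option (A i))) →
          g v ∈ Set.range (some : B → Option B)) ∧
        (∀ w : Fin (∑ j', r j') → ∀ i, Option (A i),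
          (∀ i, (fun p => w p i) ∈ starRel r (RA i)) →
          (fun p => g (w p)) ∈ starRel r RB)) := by
  classical
  constructor
  · rintro ⟨h, hh⟩
    let g : (∀ i, Option (A i)) → Option B := fun v =>
      if hv : ∀ i, (v i).isSome then some (h fun i => (v i).get (hv i)) else none
    have gsome : ∀ v : ∀ i, A i, g (fun i => some (v i)) = some (h v) := by
      intro v; simp [g]
    have gnone : ∀ v : ∀ i, Option (A i), (∃ i, v i = none) → g v = none := by
      rintro v ⟨i, hi⟩
      have : ¬ ∀ i, (v i).isSome := fun hc => by have := hc i; simp [hi] at this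
      simp only [g, dif_neg this]
    refine ⟨g, ?_, ?_⟩
    · intro v hv
      choose u hu using hv
      obtain rfl : (fun i => some (u i)) = v := funext hu
      exact ⟨h u, (gsome u).symm⟩
    · intro w hw
      by_cases hp : ∃ p, ∀ i, w p i ≠ none
      · obtain ⟨p, hp⟩ := hp
        have key : ∀ i, ∃ j, ∃ t ∈ RA i j, (fun p => w p i) = padded r j t ∧
            (blockOffset r j ≤ (p : ℕ) ∧ (p : ℕ) < blockOffset r j + r j) := by
          intro i
          rcases hw i with h0 | ⟨j, t, ht, he⟩
          · exact absurd (congrFun h0 p) (hp i)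
          · refine ⟨j, t, ht, he, padded_ne_none r j t p ?_⟩
            rw [← he]; exact hp i
        obtain ⟨j, -, -, -, hj⟩ := key ⟨0, hn⟩
        have key2 : ∀ i, ∃ t ∈ RA i j, (fun p => w p i) = padded r j t := by
          intro i
          obtain ⟨j', t, ht, he, hj'⟩ := key i
          obtain rfl := block_unique r hj hj'
          exact ⟨t, ht, he⟩
        choose t ht he using key2
        refine Or.inr ⟨j, fun q => h fun i => t i q, hh j (fun q i => t i q) ht, ?_⟩
        funext q
        have hq : w q = fun i => padded r j (t i) q := funext fun i => congrFun (he i) q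
        rw [hq]
        by_cases hb : blockOffset r j ≤ (q : ℕ) ∧ (q : ℕ) < blockOffset r j + r j
        · simp only [padded, dif_pos hb]
          exact gsome _
        · simp only [padded, dif_neg hb]
          exact gnone _ ⟨⟨0, hn⟩, rfl⟩
      · push Not at hp
        exact Or.inl (funext fun p => gnone _ (hp p))
  · rintro ⟨g, hP, hR⟩
    have hex : ∀ v : ∀ i, A i, ∃ b, some b = g (fun i => some (v i)) :=
      fun v => hP _ fun i => ⟨v i, rfl⟩
    choose h hh using hex
    refine ⟨h, fun j t ht => ?_⟩
    have hlt : ∀ q : Fin (r j), blockOffset r j + q < ∑ j', r j' := fun q => by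
      have := blockOffset_add_le r j; omega
    have hw := hR (fun p i => padded r j (fun q => t q i) p)
      (fun i => Or.inr ⟨j, _, ht i, rfl⟩)
    have hval : ∀ q : Fin (r j),
        g (fun i => padded r j (fun q => t q i) ⟨blockOffset r j + q, hlt q⟩)
          = some (h (t q)) := by
      intro q
      simp only [padded_at]
      exact (hh _).symm
    let q0 : Fin (r j) := ⟨0, hr j⟩
    rcases hw with h0 | ⟨j', t', ht', he⟩
    · have := congrFun h0 ⟨_, hlt q0⟩
      simp only [hval] at this
      cases this
    · have h1 := congrFun he ⟨_, hlt q0⟩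
      simp only [hval] at h1
      have h2 := padded_ne_none r j' t' _ (by rw [← h1]; simp)
      have hjj : j = j' := block_unique r
        (p := blockOffset r j + q0) ⟨by omega, by omega⟩ h2
      subst hjj
      have : (fun q => h (t q)) = t' := by
        funext q
        have h3 := congrFun he ⟨_, hlt q⟩
        simp only [padded_at] at h3
        exact Option.some.inj ((hh _).trans h3)
      rw [this]; exact ht'
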